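/- Let E be a real inner product space, let f : E → ℝ be differentiable with gradient ∇f, let f be μ-strongly convex on E, let ∇f be L-Lipschitz with 0 < μ ≤ L, and let x* ∈ E satisfy ∇f(x*) = 0. Let n ≥ 1 be a natural number (the number of agents) and let ᾱ be a real step size with 1/(nL) ≤ ᾱ ≤ 2/(μ+L). Then for every x̄ ∈ E: ‖(x̄ − ᾱ·∇f(x̄)) − x*‖ ≤ √(1 − 2μ/(n(μ+L)))·‖x̄ − x*‖, and 2μ/(n(μ+L)) ≤ 1, so the average iterate contracts toward x* at a Q-linear rate. -/

import Mathlib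

open RealInnerProductSpace

section SmoothConvex

variable {E : Type*} [NormedAddCommGroup E] [InnerProductSpace ℝ E]

/-- Baillon–Haddad: a gradient that is bounded below by convexity and above by a quadratic
majorant of curvature `M` is `1 / M`-cocoercive. -/
theorem norm_sub_sq_le_mul_inner_sub {h : E → ℝ} {k : E → E} {M : ℝ} (hM : 0 ≤ M)
    (hlower : ∀ x y, h x + ⟪k x, y - x⟫ ≤ h y)
    (hupper : ∀ x y, h y ≤ h x + ⟪k x, y - x⟫ + M / 2 * ‖y - x‖ ^ 2) (x y : E) :
    ‖k x - k y‖ ^ 2 ≤ M * ⟪k x - k y, x - y⟫ := by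
  have hstep (a b : E) (t : ℝ) :
      h b + ⟪k b, a - b⟫ + (t - M * t ^ 2 / 2) * ‖k a - k b‖ ^ 2 ≤ h a := by
    have h1 := hlower b (a - t • (k a - k b))
    have h2 := hupper a (a - t • (k a - k b))
    rw [sub_right_comm, inner_sub_right, real_inner_smul_right] at h1
    rw [sub_sub_cancel_left, inner_neg_right, real_inner_smul_right, norm_neg, norm_smul,
      mul_pow, Real.norm_eq_abs, sq_abs] at h2
    have h3 : ⟪k a, k a - k b⟫ - ⟪k b, k a - k b⟫ = ‖k a - k b‖ ^ 2 := by
      rw [← inner_sub_left, real_inner_self_eq_norm_sq]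
    linear_combination h1 + h2 - t * h3
  have hsum (t : ℝ) :
      (2 * t - M * t ^ 2) * ‖k x - k y‖ ^ 2 ≤ ⟪k x - k y, x - y⟫ := by
    have h1 := hstep x y t
    have h2 := hstep y x t
    rw [norm_sub_rev (k y), ← neg_sub x y, inner_neg_right] at h2
    rw [inner_sub_left]
    linear_combination h1 + h2
  rcases hM.eq_or_lt with rfl | hM
  · generalize ‖k x - k y‖ ^ 2 = w at hsum ⊢
    generalize ⟪k x - k y, x - y⟫ = p at hsum ⊢
    by_contra! hpos
    rw [zero_mul] at hpos
    have h1 := hsum ((p + 1) / (2 * w))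
    have h2 : 2 * ((p + 1) / (2 * w)) * w = p + 1 := by field_simp
    linarith
  · have h1 := mul_le_mul_of_nonneg_left (hsum (1 / M)) hM.le
    have h2 : M * ((2 * (1 / M) - M * (1 / M) ^ 2) * ‖k x - k y‖ ^ 2) = ‖k x - k y‖ ^ 2 := by
      field_simp
      ring
    linarith

variable [CompleteSpace E]

theorem HasGradientAt.hasDerivAt_line {f : E → ℝ} {g x v : E} {t : ℝ}
    (h : HasGradientAt f g (x + t • v)) :
    HasDerivAt (fun s : ℝ => f (x + s • v)) ⟪g, v⟫ t := by
  have hline : HasDerivAt (fun s : ℝ => x + s • v) v t := by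
    simpa using ((hasDerivAt_id t).smul_const v).const_add x
  exact (h.hasFDerivAt.comp_hasDerivAt t hline).congr_deriv
    (InnerProductSpace.toDual_apply_apply ..)

/-- First-order lower bound for a differentiable convex function. -/
theorem ConvexOn.add_inner_gradient_le {f : E → ℝ} {g x : E} (hf : ConvexOn ℝ Set.univ f)
    (hg : HasGradientAt f g x) (y : E) : f x + ⟪g, y - x⟫ ≤ f y := by
  have hconv : ConvexOn ℝ Set.univ (fun s : ℝ => f (x + s • (y - x))) := by
    refine ⟨convex_univ, fun a _ b _ p q hp hq hpq => ?_⟩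
    have hcomb : x + (p • a + q • b) • (y - x) =
        p • (x + a • (y - x)) + q • (x + b • (y - x)) := by
      obtain rfl : q = 1 - p := by linarith
      simp only [smul_eq_mul]
      module
    simpa only [hcomb] using hf.2 (Set.mem_univ (x + a • (y - x)))
      (Set.mem_univ (x + b • (y - x))) hp hq hpq
  have hderiv : HasDerivAt (fun s : ℝ => f (x + s • (y - x))) ⟪g, y - x⟫ 0 :=
    HasGradientAt.hasDerivAt_line (by simpa using hg)
  have hslope := hconv.le_slope_of_hasDerivAt (Set.mem_univ 0) (Set.mem_univ 1) one_pos hderiv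
  simp [slope_def_field] at hslope
  linarith

/-- Quadratic upper bound (descent lemma) for a function with Lipschitz gradient. -/
theorem le_add_inner_gradient_add_sq {f : E → ℝ} {g : E → E} {L : ℝ}
    (hg : ∀ x, HasGradientAt f (g x) x) (hlip : ∀ x y, ‖g x - g y‖ ≤ L * ‖x - y‖) (x y : E) :
    f y ≤ f x + ⟪g x, y - x⟫ + L / 2 * ‖y - x‖ ^ 2 := by
  set v := y - x with hv
  have hderiv (t : ℝ) :
      HasDerivAt (fun s : ℝ => f (x + s • v) - s * ⟪g x, v⟫ - L / 2 * ‖v‖ ^ 2 * s ^ 2)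
        (⟪g (x + t • v), v⟫ - ⟪g x, v⟫ - L * ‖v‖ ^ 2 * t) t := by
    have h := ((hg (x + t • v)).hasDerivAt_line.sub
      ((hasDerivAt_id t).mul_const ⟪g x, v⟫)).sub
      ((hasDerivAt_pow 2 t).const_mul (L / 2 * ‖v‖ ^ 2))
    exact h.congr_deriv (by push_cast; ring)
  have hanti : AntitoneOn
      (fun s : ℝ => f (x + s • v) - s * ⟪g x, v⟫ - L / 2 * ‖v‖ ^ 2 * s ^ 2)
      (Set.Ici 0) := by
    refine antitoneOn_of_deriv_nonpos (convex_Ici 0)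
      (fun t _ => (hderiv t).continuousAt.continuousWithinAt)
      (fun t _ => (hderiv t).differentiableAt.differentiableWithinAt) fun t ht => ?_
    have ht0 : 0 ≤ t := interior_subset ht
    rw [(hderiv t).deriv, ← inner_sub_left]
    have hcs := real_inner_le_norm (g (x + t • v) - g x) v
    have hn := hlip (x + t • v) x
    rw [add_sub_cancel_left, norm_smul, Real.norm_of_nonneg ht0] at hn
    nlinarith [mul_le_mul_of_nonneg_right hn (norm_nonneg v)]
  have h01 := hanti (Set.mem_Ici.2 le_rfl) (Set.mem_Ici.2 zero_le_one) zero_le_one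
  simp [hv] at h01
  linarith

theorem hasGradientAt_mul_norm_sq (c : ℝ) (x : E) :
    HasGradientAt (fun z : E => c / 2 * ‖z‖ ^ 2) (c • x) x := by
  rw [hasGradientAt_iff_hasFDerivAt]
  refine ((hasStrictFDerivAt_norm_sq x).hasFDerivAt.const_mul (c / 2)).congr_fderiv ?_
  ext z
  simp
  ring

/-- The interpolation inequality for a strongly convex function with Lipschitz gradient. -/
theorem norm_sub_sq_add_le_inner_gradient_sub {f : E → ℝ} {g : E → E} {μ L : ℝ} (hμL : μ ≤ L)
    (hg : ∀ x, HasGradientAt f (g x) x)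
    (hsc : ConvexOn ℝ Set.univ (fun x => f x - μ / 2 * ‖x‖ ^ 2))
    (hlip : ∀ x y, ‖g x - g y‖ ≤ L * ‖x - y‖) (x y : E) :
    ‖g x - g y‖ ^ 2 + μ * L * ‖x - y‖ ^ 2 ≤ (μ + L) * ⟪g x - g y, x - y⟫ := by
  have hgrad (z : E) :
      HasGradientAt (fun x => f x - μ / 2 * ‖x‖ ^ 2) (g z - μ • z) z := by
    rw [hasGradientAt_iff_hasFDerivAt, map_sub]
    exact (hg z).hasFDerivAt.sub (hasGradientAt_mul_norm_sq μ z).hasFDerivAt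
  have hco := norm_sub_sq_le_mul_inner_sub (sub_nonneg.2 hμL)
    (fun a b => hsc.add_inner_gradient_le (hgrad a) b) (fun a b => by
      have hdesc := le_add_inner_gradient_add_sq hg hlip a b
      have hexp : ‖b‖ ^ 2 = ‖a‖ ^ 2 + 2 * ⟪a, b - a⟫ + ‖b - a‖ ^ 2 := by
        rw [← norm_add_sq_real, add_sub_cancel]
      rw [inner_sub_left, real_inner_smul_left]
      linear_combination hdesc - μ / 2 * hexp) x y
  have hw : g x - μ • x - (g y - μ • y) = (g x - g y) - μ • (x - y) := by module
  rw [hw, norm_sub_sq_real, inner_sub_left _ (μ • (x - y)), real_inner_smul_left, real_inner_smul_right,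
    norm_smul, mul_pow, Real.norm_eq_abs, sq_abs, real_inner_self_eq_norm_sq] at hco
  linear_combination hco

end SmoothConvex


/-- Contraction of the consensus average iterate (Lemmas 4 and 6 of the paper): for a
`μ`-strongly convex `f` with `L`-Lipschitz gradient, `∇f(x*) = 0`, `n ≥ 1` agents, and
average step size `1/(nL) ≤ ᾱ ≤ 2/(μ+L)`, one gradient step contracts toward `x*` with
factor `√(1 - 2μ/(n(μ+L)))`, and `2μ/(n(μ+L)) ≤ 1`. -/
theorem average_iterate_contraction
    {E : Type*} [NormedAddCommGroup E] [InnerProductSpace ℝ E] [CompleteSpace E]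
    (f : E → ℝ) (g : E → E) (μ L : ℝ) (xstar : E)
    (hμ : 0 < μ) (hμL : μ ≤ L)
    (hgrad : ∀ x, HasGradientAt f (g x) x)
    (hsc : ConvexOn ℝ Set.univ (fun x => f x - μ / 2 * ‖x‖ ^ 2))
    (hlip : ∀ x y, ‖g x - g y‖ ≤ L * ‖x - y‖)
    (hopt : g xstar = 0)
    (n : ℕ) (hn : 1 ≤ n)
    (αbar : ℝ) (hα_lb : 1 / (n * L) ≤ αbar) (hα_ub : αbar ≤ 2 / (μ + L)) :
    (∀ xbar : E,
      ‖(xbar - αbar • g xbar) - xstar‖ ≤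
        Real.sqrt (1 - 2 * μ / (n * (μ + L))) * ‖xbar - xstar‖) ∧
    2 * μ / (n * (μ + L)) ≤ 1 := by
  have hL : 0 < L := hμ.trans_le hμL
  have hn1 : (1 : ℝ) ≤ n := by exact_mod_cast hn
  have hn0 : (0 : ℝ) < n := by linarith
  have hs : 0 < μ + L := by linarith
  have hα : 0 ≤ αbar := le_trans (by positivity) hα_lb
  refine ⟨fun xbar => ?_, ?_⟩
  · have hint := norm_sub_sq_add_le_inner_gradient_sub hμL hgrad hsc hlip xbar xstar
    rw [hopt, sub_zero] at hint
    rw [← Real.sqrt_sq (norm_nonneg (xbar - xstar)), ← Real.sqrt_mul' _ (sq_nonneg _)]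
    apply Real.le_sqrt_of_sq_le
    have hvec : xbar - αbar • g xbar - xstar = (xbar - xstar) - αbar • g xbar := by abel
    rw [hvec, norm_sub_sq_real, real_inner_smul_right, norm_smul, mul_pow, Real.norm_eq_abs,
      sq_abs, real_inner_comm]
    set d := ‖xbar - xstar‖ ^ 2
    set G := ‖g xbar‖ ^ 2
    set p := ⟪g xbar, xbar - xstar⟫
    have hd : 0 ≤ d := sq_nonneg _
    have hG : 0 ≤ G := sq_nonneg _
    have hub : αbar * (μ + L) ≤ 2 := (le_div_iff₀ hs).1 hα_ub
    have hlb : 1 / n ≤ αbar * L := by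
      rw [div_le_iff₀ (by positivity)] at hα_lb ⊢
      linarith
    have hrate : 2 * μ / (n * (μ + L)) * (μ + L) = 2 * μ * (1 / n) := by
      field_simp
    refine le_of_mul_le_mul_right ?_ hs
    have h1 := mul_le_mul_of_nonneg_left hint (mul_nonneg zero_le_two hα)
    have h2 := mul_nonneg (mul_nonneg hα hG) (sub_nonneg.2 hub)
    have h3 := mul_nonneg (mul_nonneg hμ.le hd) (sub_nonneg.2 hlb)
    linear_combination h1 + h2 + 2 * h3 + d * hrate
  · rw [div_le_one (by positivity)]
    nlinarith
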